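/- Let M be a matroid of rank r on a ground set of size n and let C be a circuit of M. Then the winning probability satisfies β_C ≤ binom(r+1, |C|) / binom(n, |C|), equivalently β_C ≤ ((r+1)! · (n-|C|)!) / (n! · (r+1-|C|)!). -/

import Mathlib

open Finset

/-- A matroid presented by its collection of circuits (the valid sets of bingo
cards): nonempty ground set axioms (C1)-(C3) of the paper. -/
structure BingoMatroid (α : Type*) [DecidableEq α] where
  /-- the ground set -/
  E : Finset α
  /-- the circuits (bingo cards) -/
  circuits : Finset (Finset α)
  subset_ground : ∀ C ∈ circuits, C ⊆ E
  empty_not_mem : ∅ ∉ circuits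
  antichain : ∀ C₁ ∈ circuits, ∀ C₂ ∈ circuits, C₁ ⊆ C₂ → C₁ = C₂
  elimination : ∀ C₁ ∈ circuits, ∀ C₂ ∈ circuits, C₁ ≠ C₂ →
    ∀ e ∈ C₁ ∩ C₂, ∃ C₃ ∈ circuits, C₃ ⊆ (C₁ ∪ C₂) \ {e}

/-- The completion time `t_C(σ)`: the least `t` such that every element of `C`
has been called out among the first `t` values of `σ`. -/
noncomputable def hitTime {α : Type*} {n : ℕ} (σ : Fin n → α) (C : Finset α) : ℕ :=
  sInf {t : ℕ | ∀ x ∈ C, ∃ i : Fin n, (i : ℕ) < t ∧ σ i = x}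

namespace BingoMatroid

variable {α : Type*} [DecidableEq α]

/-- `C` wins the bingo game under calling order `σ`: it is completed strictly
before every other circuit. -/
def Wins (M : BingoMatroid α) (σ : Fin M.E.card ≃ {x // x ∈ M.E}) (C : Finset α) : Prop :=
  ∀ C' ∈ M.circuits, C' ≠ C →
    hitTime (fun i => (σ i : α)) C < hitTime (fun i => (σ i : α)) C'

/-- The winning probability `β_C`: the number of calling orders under which `C`
wins, divided by `n!`. -/
noncomputable def beta (M : BingoMatroid α) (C : Finset α) : ℚ :=
  (Nat.card {σ : Fin M.E.card ≃ {x // x ∈ M.E} // M.Wins σ C} : ℚ) /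
    (Nat.factorial M.E.card : ℚ)

/-- The timed winning probability `β_C(t)`: the probability that `C` wins and is
completed exactly in round `t`. -/
noncomputable def betaT (M : BingoMatroid α) (C : Finset α) (t : ℕ) : ℚ :=
  (Nat.card {σ : Fin M.E.card ≃ {x // x ∈ M.E} //
      M.Wins σ C ∧ hitTime (fun i => (σ i : α)) C = t} : ℚ) /
    (Nat.factorial M.E.card : ℚ)

/-- A set is independent if it is contained in the ground set and contains no circuit. -/
def Indep (M : BingoMatroid α) (I : Finset α) : Prop :=
  I ⊆ M.E ∧ ∀ C ∈ M.circuits, ¬ C ⊆ I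

/-- The rank of the matroid: the maximum size of an independent set. -/
noncomputable def rank (M : BingoMatroid α) : ℕ :=
  sSup {k : ℕ | ∃ I : Finset α, M.Indep I ∧ I.card = k}

/-- A basis is a maximal independent set. -/
def IsBase (M : BingoMatroid α) (B : Finset α) : Prop :=
  M.Indep B ∧ ∀ J : Finset α, M.Indep J → B ⊆ J → B = J

/-- A coloop is an element of the ground set contained in no circuit. -/
def IsColoop (M : BingoMatroid α) (e : α) : Prop :=
  e ∈ M.E ∧ ∀ C ∈ M.circuits, e ∉ C

/-- `D` is a circuit of the contraction `M/T`: a nonempty inclusion-minimal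
member of `{C \ T : C a circuit of M}`. -/
def IsContractCircuit (M : BingoMatroid α) (T D : Finset α) : Prop :=
  D.Nonempty ∧ (∃ C ∈ M.circuits, D = C \ T) ∧
    ∀ C' ∈ M.circuits, (C' \ T).Nonempty → ¬ (C' \ T) ⊂ D

end BingoMatroid

theorem card_equiv_symm_mem_eq_of_card_eq {ι β : Type*} [Fintype ι] [Fintype β] [DecidableEq ι]
    [DecidableEq β] (T : Finset ι) {C D : Finset β} (h : C.card = D.card) :
    Fintype.card {σ : ι ≃ β // ∀ x ∈ C, σ.symm x ∈ T} =
      Fintype.card {σ : ι ≃ β // ∀ x ∈ D, σ.symm x ∈ T} := by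
  let π : Equiv.Perm β := (Finset.equivOfCardEq h).extendSubtype
  have hπ (x : β) : π x ∈ D ↔ x ∈ C := by
    refine ⟨fun hx => ?_, fun hx => Equiv.extendSubtype_mem _ x hx⟩
    by_contra hxC
    exact Equiv.extendSubtype_not_mem _ x hxC hx
  refine Fintype.card_congr (Equiv.subtypeEquiv (Equiv.equivCongr (Equiv.refl ι) π) fun σ => ?_)
  constructor
  · intro hσ x hx
    have hx' : π.symm x ∈ C := by rwa [← hπ, Equiv.apply_symm_apply]
    simpa using hσ _ hx'
  · intro hσ x hx
    simpa using hσ _ ((hπ x).2 hx)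

/-- A uniformly random bijection pulls a `c`-subset `C` of `β` back into `T` with probability
`(#T choose c) / (#β choose c)`. -/
theorem card_equiv_symm_mem_mul_choose {ι β : Type*} [Fintype ι] [Fintype β] [DecidableEq ι]
    [DecidableEq β] (T : Finset ι) (C : Finset β) :
    Fintype.card {σ : ι ≃ β // ∀ x ∈ C, σ.symm x ∈ T} * (Fintype.card β).choose C.card =
      Fintype.card (ι ≃ β) * T.card.choose C.card := by
  have key := Finset.sum_card_bipartiteAbove_eq_sum_card_bipartiteBelow
    (s := Finset.powersetCard C.card (Finset.univ : Finset β))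
    (t := (Finset.univ : Finset (ι ≃ β))) (fun D σ => ∀ x ∈ D, σ.symm x ∈ T)
  rw [Finset.sum_const_nat (m := Fintype.card {σ : ι ≃ β // ∀ x ∈ C, σ.symm x ∈ T}),
    Finset.sum_const_nat (m := T.card.choose C.card)] at key
  · simpa [mul_comm] using key
  · intro σ _
    have : Finset.bipartiteBelow (fun (D : Finset β) (σ : ι ≃ β) => ∀ x ∈ D, σ.symm x ∈ T)
        (Finset.powersetCard C.card Finset.univ) σ =
        Finset.powersetCard C.card (T.map σ.toEmbedding) := by
      ext D
      simp [Finset.mem_bipartiteBelow, Finset.mem_powersetCard, Finset.subset_iff, and_comm]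
    rw [this, Finset.card_powersetCard, Finset.card_map]
  · intro D hD
    rw [card_equiv_symm_mem_eq_of_card_eq T (Finset.mem_powersetCard.1 hD).2.symm,
      Fintype.card_subtype]
    rfl

namespace BingoMatroid

variable {α : Type*} [DecidableEq α]

theorem Indep.card_le_rank {M : BingoMatroid α} {I : Finset α} (hI : M.Indep I) :
    I.card ≤ M.rank := by
  refine le_csSup ⟨M.E.card, ?_⟩ ⟨I, hI, rfl⟩
  rintro k ⟨J, hJ, rfl⟩
  exact Finset.card_le_card hJ.1

theorem hitTime_le_card (M : BingoMatroid α) (σ : Fin M.E.card ≃ {x // x ∈ M.E})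
    {C : Finset α} (hC : C ⊆ M.E) : hitTime (fun i => (σ i : α)) C ≤ M.E.card :=
  Nat.sInf_le fun x hx => ⟨σ.symm ⟨x, hC hx⟩, Fin.is_lt _, by simp⟩

theorem exists_lt_hitTime (M : BingoMatroid α) (σ : Fin M.E.card ≃ {x // x ∈ M.E})
    {C : Finset α} (hC : C ⊆ M.E) {x : α} (hx : x ∈ C) :
    ∃ i : Fin M.E.card, (i : ℕ) < hitTime (fun i => (σ i : α)) C ∧ (σ i : α) = x :=
  Nat.sInf_mem (s := {t : ℕ | ∀ x ∈ C, ∃ i : Fin M.E.card, (i : ℕ) < t ∧ (σ i : α) = x})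
    ⟨M.E.card, fun y hy => ⟨σ.symm ⟨y, hC hy⟩, Fin.is_lt _, by simp⟩⟩ x hx

theorem Wins.hitTime_le_rank_add_one {M : BingoMatroid α}
    {σ : Fin M.E.card ≃ {x // x ∈ M.E}} {C : Finset α} (hC : C ∈ M.circuits)
    (h : M.Wins σ C) : hitTime (fun i => (σ i : α)) C ≤ M.rank + 1 := by
  have hCE := M.subset_ground C hC
  obtain ⟨e, he⟩ : C.Nonempty :=
    Finset.nonempty_iff_ne_empty.2 fun h0 => M.empty_not_mem (h0 ▸ hC)
  set t := hitTime (fun i => (σ i : α)) C with ht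
  have htn : t ≤ M.E.card := hitTime_le_card M σ hCE
  let T : Finset α := (Finset.univ.filter fun i : Fin M.E.card => (i : ℕ) < t).map
    (σ.toEmbedding.trans (Function.Embedding.subtype _))
  have hT : T.card = t := by
    simp [T, Fin.card_filter_val_lt, htn]
  have hind : M.Indep (T.erase e) := by
    refine ⟨fun x hx => ?_, fun C' hC' hsub => ?_⟩
    · obtain ⟨i, -, rfl⟩ := Finset.mem_map.1 (Finset.mem_of_mem_erase hx)
      exact (σ i).2
    · have hne : C' ≠ C := by
        rintro rfl
        exact Finset.notMem_erase e T (hsub he)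
      refine (h C' hC' hne).not_ge (Nat.sInf_le fun x hx => ?_)
      obtain ⟨i, hi, rfl⟩ := Finset.mem_map.1 (Finset.mem_of_mem_erase (hsub hx))
      exact ⟨i, (Finset.mem_filter.1 hi).2, rfl⟩
  have h1 := hind.card_le_rank
  have h2 := Finset.pred_card_le_card_erase (s := T) (a := e)
  omega

end BingoMatroid

/-- upper bound `β_C ≤ binom(r+1,|C|)/binom(n,|C|)`. -/
theorem stmt5 {α : Type*} [DecidableEq α] (M : BingoMatroid α) (hE : M.E.Nonempty)
    (C : Finset α) (hC : C ∈ M.circuits) :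
    M.beta C ≤ (Nat.choose (M.rank + 1) C.card : ℚ) / (Nat.choose M.E.card C.card : ℚ) := by
  have hCE := M.subset_ground C hC
  let T : Finset (Fin M.E.card) := Finset.univ.filter fun i => (i : ℕ) < M.rank + 1
  let D : Finset {x // x ∈ M.E} := C.subtype (· ∈ M.E)
  have hD : D.card = C.card := by
    rw [Finset.card_subtype, Finset.filter_true_of_mem fun x hx => hCE hx]
  have hT : T.card ≤ M.rank + 1 := by
    exact (Fin.card_filter_val_lt ..).trans_le (min_le_right _ _)
  have hcount := card_equiv_symm_mem_mul_choose T D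
  rw [Fintype.card_equiv M.E.equivFin.symm, Fintype.card_coe, Fintype.card_fin, hD] at hcount
  have hle : Nat.card {σ : Fin M.E.card ≃ {x // x ∈ M.E} // M.Wins σ C} ≤
      Fintype.card {σ : Fin M.E.card ≃ {x // x ∈ M.E} // ∀ x ∈ D, σ.symm x ∈ T} := by
    rw [← Nat.card_eq_fintype_card]
    refine Nat.card_mono (Set.toFinite _) fun σ hσ x hx => ?_
    obtain ⟨i, hi, hix⟩ := M.exists_lt_hitTime σ hCE (Finset.mem_subtype.1 hx)
    obtain rfl : σ i = x := Subtype.ext hix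
    simpa [T, Nat.lt_succ_iff] using
      hi.trans_le (BingoMatroid.Wins.hitTime_le_rank_add_one hC hσ)
  have hchoose : 0 < M.E.card.choose C.card := Nat.choose_pos (Finset.card_le_card hCE)
  rw [BingoMatroid.beta, div_le_div_iff₀ (by positivity) (by exact_mod_cast hchoose)]
  norm_cast
  calc _ ≤ _ := Nat.mul_le_mul_right _ hle
    _ = _ := hcount
    _ ≤ _ := Nat.mul_le_mul_left _ (Nat.choose_le_choose _ hT)
    _ = _ := mul_comm _ _
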